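/- arXiv:2106.07138 — 2 statements merged into one kernel-verified Lean document; each statement's English description precedes it below -/
import Mathlib

section
/- Let Σ ∈ R^{d×d} be a nonzero symmetric positive semidefinite matrix with eigenvalues a_1 ≥ a_2 ≥ … ≥ a_d ≥ 0, and let ε_1, ε_2 be independent Gaussian random vectors with distribution N(0, Σ). Then: (i) for every real λ with |λ| a_1 < 1, E exp(λ ⟨ε_1, ε_2⟩) = ∏_{i=1}^d (1 − λ² a_i²)^{−1/2}; and (ii) for every t > 0, P(|⟨ε_1, ε_2⟩| > a_1 t + sqrt(2 t Σ_{i=1}^d a_i²)) ≤ 2 e^{−t}, i.e., P(|⟨ε_1, ε_2⟩| > ‖Σ‖ t + sqrt(2 ‖Σ‖_F² t)) ≤ 2 e^{−t}. -/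
open MeasureTheory ProbabilityTheory Matrix

/-- The spectral (operator) norm of a real matrix, as the operator norm of the induced
linear map between Euclidean spaces. -/
noncomputable def specNorm {d e : ℕ} (A : Matrix (Fin d) (Fin e) ℝ) : ℝ :=
  ‖LinearMap.toContinuousLinearMap (Matrix.toEuclideanLin A)‖

/-- The Frobenius norm of a real matrix. -/
noncomputable def frobNorm {d e : ℕ} (A : Matrix (Fin d) (Fin e) ℝ) : ℝ :=
  Real.sqrt (∑ i, ∑ j, (A i j) ^ 2)

/-- `W` is a (possibly degenerate) Gaussian random vector with mean `mean` and covariance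
matrix `C` under `μ`: every linear functional of `W` has the corresponding one-dimensional
Gaussian law. -/
def IsGaussianVec {Ω : Type*} [MeasurableSpace Ω] (μ : Measure Ω) {p : ℕ}
    (W : Ω → Fin p → ℝ) (mean : Fin p → ℝ) (C : Matrix (Fin p) (Fin p) ℝ) : Prop :=
  ∀ a : Fin p → ℝ,
    Measure.map (fun ω => ∑ i, a i * W ω i) μ =
      ProbabilityTheory.gaussianReal (∑ i, a i * mean i) (Real.toNNReal (a ⬝ᵥ C.mulVec a))

/-- The moment generating function of the square of a centred Gaussian variable. -/
lemma integral_exp_mul_sq_gaussianReal (v : NNReal) {s : ℝ} (hs : 2 * s * v < 1) :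
    ∫ x, Real.exp (s * x ^ 2) ∂(gaussianReal 0 v) = (1 - 2 * s * v) ^ (-(1 : ℝ) / 2) := by
  by_cases hv : v = 0
  · simp [hv]
  have hvp : (0 : ℝ) < v := by positivity
  have hq : 0 < 1 - 2 * s * v := by linarith
  rw [integral_gaussianReal_eq_integral_smul hv]
  have h : ∀ x : ℝ, gaussianPDFReal 0 v x • Real.exp (s * x ^ 2)
      = (√(2 * Real.pi * v))⁻¹ * Real.exp (-((1 - 2 * s * v) / (2 * v)) * x ^ 2) := by
    intro x
    rw [gaussianPDFReal, smul_eq_mul, mul_assoc, ← Real.exp_add]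
    congr 2
    field_simp
    ring
  simp_rw [h]
  rw [integral_const_mul, integral_gaussian,
    show Real.pi / ((1 - 2 * s * v) / (2 * v)) = (2 * Real.pi * v) / (1 - 2 * s * v) by field_simp,
    Real.sqrt_div (by positivity), neg_div, Real.rpow_neg hq.le, ← Real.sqrt_eq_rpow]
  have : √(2 * Real.pi * v) ≠ 0 := by positivity
  field_simp

lemma specNorm_nonneg {d e : ℕ} (A : Matrix (Fin d) (Fin e) ℝ) : 0 ≤ specNorm A :=
  norm_nonneg _

lemma toEuclideanLin_eigenvectorBasis {d : ℕ} {S : Matrix (Fin d) (Fin d) ℝ}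
    (hS : S.IsHermitian) (k : Fin d) :
    LinearMap.toContinuousLinearMap (Matrix.toEuclideanLin S) (hS.eigenvectorBasis k)
      = hS.eigenvalues k • hS.eigenvectorBasis k := by
  ext i
  simpa using congrFun (hS.mulVec_eigenvectorBasis k) i

lemma abs_eigenvalues_le_specNorm {d : ℕ} {S : Matrix (Fin d) (Fin d) ℝ} (hS : S.IsHermitian)
    (k : Fin d) : |hS.eigenvalues k| ≤ specNorm S := by
  have h := (LinearMap.toContinuousLinearMap (Matrix.toEuclideanLin S)).le_opNorm
    (hS.eigenvectorBasis k)
  rw [toEuclideanLin_eigenvectorBasis, norm_smul, hS.eigenvectorBasis.norm_eq_one] at h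
  simpa [specNorm] using h

lemma dotProduct_mulVec_eq_sum_eigenvalues {d : ℕ} {S : Matrix (Fin d) (Fin d) ℝ}
    (hS : S.IsHermitian) (x : Fin d → ℝ) :
    x ⬝ᵥ S.mulVec x
      = ∑ k, hS.eigenvalues k * (∑ i, hS.eigenvectorBasis k i * x i) ^ 2 := by
  have h := hS.spectral_theorem
  rw [Unitary.conjStarAlgAut_apply] at h
  conv_lhs => rw [h]
  rw [← Matrix.mulVec_mulVec, ← Matrix.mulVec_mulVec, Matrix.dotProduct_mulVec]
  simp only [dotProduct, Matrix.mulVec_diagonal]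
  simp only [dotProduct, Matrix.vecMul, Matrix.mulVec, Matrix.star_apply,
    hS.eigenvectorUnitary_apply, star_trivial, Function.comp_apply]
  refine Finset.sum_congr rfl fun k _ => ?_
  simp only [RCLike.ofReal_real_eq_id, id]
  rw [Finset.sum_congr rfl fun i _ => mul_comm (x i) _]
  ring

lemma sum_sq_eigenvalues {d : ℕ} {S : Matrix (Fin d) (Fin d) ℝ} (hS : S.IsHermitian) :
    ∑ k, hS.eigenvalues k ^ 2 = frobNorm S ^ 2 := by
  rw [frobNorm, Real.sq_sqrt (by positivity)]
  have h : ∀ k, hS.eigenvalues k ^ 2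
      = ‖LinearMap.toContinuousLinearMap (Matrix.toEuclideanLin S) (hS.eigenvectorBasis k)‖ ^ 2 := by
    intro k
    rw [toEuclideanLin_eigenvectorBasis, norm_smul, hS.eigenvectorBasis.norm_eq_one]
    simp
  simp_rw [h, EuclideanSpace.real_norm_sq_eq]
  rw [Finset.sum_comm]
  refine Finset.sum_congr rfl fun i _ => ?_
  have h3 := hS.eigenvectorBasis.sum_sq_inner_right (WithLp.toLp 2 (S i))
  rw [EuclideanSpace.real_norm_sq_eq] at h3
  rw [← h3]
  refine Finset.sum_congr rfl fun k _ => ?_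
  congr 1

lemma frobNorm_sq_pos {d e : ℕ} {A : Matrix (Fin d) (Fin e) ℝ} (hA : A ≠ 0) :
    0 < frobNorm A ^ 2 := by
  rw [frobNorm, Real.sq_sqrt (by positivity)]
  by_contra! h
  apply hA
  ext i j
  have h0 : ∑ i, ∑ j, A i j ^ 2 = 0 := le_antisymm h (by positivity)
  rw [Finset.sum_eq_zero_iff_of_nonneg fun i _ => by positivity] at h0
  have h1 := h0 i (Finset.mem_univ i)
  rw [Finset.sum_eq_zero_iff_of_nonneg fun i _ => by positivity] at h1
  simpa using h1 j (Finset.mem_univ j)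

section Gaussian

variable {Ω : Type*} [MeasurableSpace Ω] {μ : Measure Ω} {d : ℕ}
  {S : Matrix (Fin d) (Fin d) ℝ} {ε : Ω → Fin d → ℝ}

/-- The coordinates in an eigenbasis of the linear combination with coefficients `t`. -/
lemma IsGaussianVec.map_sum_eigenvector (hS : S.IsHermitian) (hg : IsGaussianVec μ ε 0 S)
    (t : Fin d → ℝ) :
    μ.map (fun ω => ∑ k, t k * ∑ i, hS.eigenvectorBasis k i * ε ω i)
      = gaussianReal 0 (∑ k, hS.eigenvalues k * t k ^ 2).toNNReal := by
  have h := hg (fun i => ∑ k, t k * hS.eigenvectorBasis k i)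
  rw [dotProduct_mulVec_eq_sum_eigenvalues hS] at h
  have h2 : ∀ k, ∑ i, hS.eigenvectorBasis k i * ∑ l, t l * hS.eigenvectorBasis l i = t k := by
    intro k
    have h3 : ∀ l, ∑ i, hS.eigenvectorBasis k i * hS.eigenvectorBasis l i
        = if k = l then 1 else 0 := by
      intro l
      rw [← orthonormal_iff_ite.1 hS.eigenvectorBasis.orthonormal k l]
      simp [PiLp.inner_apply, mul_comm]
    simp_rw [Finset.mul_sum]
    rw [Finset.sum_comm]
    simp_rw [mul_left_comm _ (t _), ← Finset.mul_sum, h3]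
    simp
  simp_rw [h2] at h
  convert h using 2
  · ext ω
    simp_rw [Finset.mul_sum, Finset.sum_mul]
    rw [Finset.sum_comm]
    simp_rw [mul_assoc]
  · simp

lemma IsGaussianVec.map_eigenvector (hS : S.IsHermitian) (hg : IsGaussianVec μ ε 0 S)
    (k : Fin d) :
    μ.map (fun ω => ∑ i, hS.eigenvectorBasis k i * ε ω i)
      = gaussianReal 0 (hS.eigenvalues k).toNNReal := by
  simpa [Pi.single_apply, ite_pow] using hg.map_sum_eigenvector hS (Pi.single k 1)

lemma IsGaussianVec.iIndepFun_eigenvector [IsProbabilityMeasure μ] (hS : S.PosSemidef)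
    (hε : Measurable ε) (hg : IsGaussianVec μ ε 0 S) :
    iIndepFun (fun k ω => ∑ i, hS.1.eigenvectorBasis k i * ε ω i) μ := by
  rw [iIndepFun_iff_charFun_pi fun k => by fun_prop]
  intro t
  have h : charFun (μ.map fun ω => WithLp.toLp 2
        fun k => ∑ i, hS.1.eigenvectorBasis k i * ε ω i) t
      = charFun (μ.map fun ω => ∑ k, t k * ∑ i, hS.1.eigenvectorBasis k i * ε ω i) 1 := by
    rw [charFun_apply, charFun_apply, integral_map (by fun_prop) (by fun_prop),
      integral_map (by fun_prop) (by fun_prop)]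
    simp [PiLp.inner_apply]
  have h0 : ∀ k, 0 ≤ hS.1.eigenvalues k := hS.eigenvalues_nonneg
  rw [h, hg.map_sum_eigenvector hS.1, charFun_gaussianReal]
  simp_rw [hg.map_eigenvector hS.1, charFun_gaussianReal]
  rw [← Complex.exp_sum, Real.coe_toNNReal _
    (Finset.sum_nonneg fun k _ => mul_nonneg (h0 k) (sq_nonneg _))]
  simp_rw [Real.coe_toNNReal _ (h0 _)]
  congr 1
  simp [Finset.sum_div, Finset.sum_neg_distrib]

/-- The moment generating function of the quadratic form `εᵀ S ε` of a Gaussian vector with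
covariance matrix `S`. -/
lemma IsGaussianVec.integral_exp_quadratic [IsProbabilityMeasure μ] (hS : S.PosSemidef)
    (hε : Measurable ε) (hg : IsGaussianVec μ ε 0 S) {s : ℝ}
    (hs : ∀ k, 2 * s * hS.1.eigenvalues k ^ 2 < 1) :
    ∫ ω, Real.exp (s * (ε ω ⬝ᵥ S.mulVec (ε ω))) ∂μ
      = ∏ k, (1 - 2 * s * hS.1.eigenvalues k ^ 2) ^ (-(1 : ℝ) / 2) := by
  set Y : Fin d → Ω → ℝ := fun k ω =>
    hS.1.eigenvalues k * (∑ i, hS.1.eigenvectorBasis k i * ε ω i) ^ 2 with hY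
  have hind : iIndepFun Y μ := (hg.iIndepFun_eigenvector hS hε).comp
    (fun k x => hS.1.eigenvalues k * x ^ 2) fun k => by fun_prop
  have h := hind.mgf_sum (t := s) (fun k => by fun_prop) Finset.univ
  simp only [mgf, Finset.sum_apply] at h
  simp_rw [dotProduct_mulVec_eq_sum_eigenvalues hS.1]
  rw [h]
  refine Finset.prod_congr rfl fun k _ => ?_
  have h0 : ((hS.1.eigenvalues k).toNNReal : ℝ) = hS.1.eigenvalues k :=
    Real.coe_toNNReal _ (hS.eigenvalues_nonneg k)
  have h1 := integral_exp_mul_sq_gaussianReal (hS.1.eigenvalues k).toNNReal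
    (s := s * hS.1.eigenvalues k) (by rw [h0]; linarith [hs k])
  rw [← hg.map_eigenvector hS.1, integral_map (by fun_prop) (by fun_prop), h0] at h1
  simp only [hY]
  convert h1 using 2
  · simp_rw [mul_assoc]
  · ring

end Gaussian

section Decoupled

variable {Ω : Type*} [MeasurableSpace Ω] {μ : Measure Ω} {d : ℕ}
  {S : Matrix (Fin d) (Fin d) ℝ} {ε₁ ε₂ : Ω → Fin d → ℝ}

lemma IsGaussianVec.mgf_dotProduct (hg : IsGaussianVec μ ε₁ 0 S) (hS : S.PosSemidef)
    (x : Fin d → ℝ) (s : ℝ) :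
    mgf (fun ω => ∑ i, x i * ε₁ ω i) μ s = Real.exp (s ^ 2 / 2 * (x ⬝ᵥ S.mulVec x)) := by
  have h0 : 0 ≤ x ⬝ᵥ S.mulVec x := by simpa using hS.dotProduct_mulVec_nonneg x
  rw [mgf_gaussianReal (hg x), Real.coe_toNNReal _ h0]
  congr 1
  simp
  ring

lemma sq_mul_sq_lt_one {s c a : ℝ} (hs : |s| * c < 1) (ha : |a| ≤ c) : s ^ 2 * a ^ 2 < 1 := by
  have h1 : |s| * |a| < 1 := (mul_le_mul_of_nonneg_left ha (abs_nonneg s)).trans_lt hs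
  rw [← mul_pow, sq_lt_one_iff_abs_lt_one, abs_mul]
  exact h1

lemma integrable_and_integral_exp_mul_inner [IsProbabilityMeasure μ] (hS : S.PosSemidef)
    (h1 : Measurable ε₁) (h2 : Measurable ε₂) (hind : IndepFun ε₁ ε₂ μ)
    (hg1 : IsGaussianVec μ ε₁ 0 S) (hg2 : IsGaussianVec μ ε₂ 0 S) {s : ℝ}
    (hs : |s| * specNorm S < 1) :
    Integrable (fun ω => Real.exp (s * ∑ i, ε₁ ω i * ε₂ ω i)) μ ∧
    ∫ ω, Real.exp (s * ∑ i, ε₁ ω i * ε₂ ω i) ∂μ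
        = ∏ i, (1 - s ^ 2 * (hS.1.eigenvalues i) ^ 2) ^ (-(1 : ℝ) / 2) := by
  have hlt : ∀ k, s ^ 2 * hS.1.eigenvalues k ^ 2 < 1 := fun k =>
    sq_mul_sq_lt_one hs (abs_eigenvalues_le_specNorm hS.1 k)
  set f : (Fin d → ℝ) × (Fin d → ℝ) → ℝ := fun p => Real.exp (s * ∑ i, p.1 i * p.2 i) with hf
  have hfm : Measurable f := by fun_prop
  have hmap := hind.map_prod_eq_prod_map_map h1.aemeasurable h2.aemeasurable
  have := Measure.isProbabilityMeasure_map (μ := μ) h1.aemeasurable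
  have := Measure.isProbabilityMeasure_map (μ := μ) h2.aemeasurable
  have hinner : ∀ x, ∫ y, f (x, y) ∂(μ.map ε₂)
      = Real.exp (s ^ 2 / 2 * (x ⬝ᵥ S.mulVec x)) := by
    intro x
    rw [integral_map h2.aemeasurable (by fun_prop)]
    exact hg2.mgf_dotProduct hS x s
  have hinner_int : ∀ x, Integrable (fun y => f (x, y)) (μ.map ε₂) := fun x =>
    Integrable.of_integral_ne_zero (by rw [hinner]; positivity)
  have hquad := hg1.integral_exp_quadratic hS h1 (s := s ^ 2 / 2)
    fun k => by linarith [hlt k]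
  simp_rw [mul_div_cancel₀ (s ^ 2) (two_ne_zero' ℝ)] at hquad
  have hquadm : Measurable fun x : Fin d → ℝ =>
      Real.exp (s ^ 2 / 2 * (x ⬝ᵥ S.mulVec x)) := by
    simp only [dotProduct, Matrix.mulVec]
    fun_prop
  have houter : ∫ x, Real.exp (s ^ 2 / 2 * (x ⬝ᵥ S.mulVec x)) ∂(μ.map ε₁)
      = ∏ i, (1 - s ^ 2 * (hS.1.eigenvalues i) ^ 2) ^ (-(1 : ℝ) / 2) := by
    rw [integral_map h1.aemeasurable hquadm.aestronglyMeasurable, hquad]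
  have hint : Integrable f ((μ.map ε₁).prod (μ.map ε₂)) := by
    rw [integrable_prod_iff hfm.aestronglyMeasurable]
    refine ⟨ae_of_all _ hinner_int, ?_⟩
    have hnorm : ∀ p, ‖f p‖ = f p := fun p => Real.norm_of_nonneg (Real.exp_nonneg _)
    simp_rw [hnorm, hinner]
    refine Integrable.of_integral_ne_zero ?_
    rw [houter]
    exact (Finset.prod_pos fun k _ => Real.rpow_pos_of_pos (by linarith [hlt k]) _).ne'
  constructor
  · rw [← hmap] at hint
    exact hint.comp_measurable (h1.prodMk h2)
  · have h := integral_map (h1.prodMk h2).aemeasurable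
      (hfm.aestronglyMeasurable (μ := μ.map fun ω => (ε₁ ω, ε₂ ω)))
    rw [hmap, integral_prod _ hint] at h
    simp_rw [hinner] at h
    rw [← houter, h]

/-- The sub-gamma bound for one factor of the moment generating function. -/
lemma one_sub_sq_rpow_le_exp {s c a : ℝ} (h0 : 0 ≤ s) (hs : s * c < 1) (ha : |a| ≤ c) :
    (1 - s ^ 2 * a ^ 2) ^ (-(1 : ℝ) / 2) ≤ Real.exp (s ^ 2 * a ^ 2 / (2 * (1 - s * c))) := by
  have hu : 0 ≤ s * |a| := by positivity
  have huc : s * |a| ≤ s * c := by gcongr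
  have hsq : s ^ 2 * a ^ 2 = (s * |a|) ^ 2 := by rw [mul_pow, sq_abs]
  have hle : 1 - s * c ≤ 1 - s ^ 2 * a ^ 2 := by rw [hsq]; nlinarith
  have hpos : 0 < 1 - s * c := by linarith
  have hpos' : 0 < 1 - s ^ 2 * a ^ 2 := hpos.trans_le hle
  rw [Real.rpow_def_of_pos hpos', Real.exp_le_exp]
  have hlog := Real.one_sub_inv_le_log_of_pos hpos'
  have hinv : (1 - s ^ 2 * a ^ 2)⁻¹ - 1 ≤ s ^ 2 * a ^ 2 / (1 - s * c) := by
    calc (1 - s ^ 2 * a ^ 2)⁻¹ - 1 = s ^ 2 * a ^ 2 / (1 - s ^ 2 * a ^ 2) := by field_simp; ring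
      _ ≤ _ := by gcongr
  have heq : s ^ 2 * a ^ 2 / (2 * (1 - s * c)) = s ^ 2 * a ^ 2 / (1 - s * c) / 2 := by
    field_simp
  rw [heq]
  linarith

/-- Chernoff's bound for a variable whose moment generating function is sub-gamma with variance
factor `v` and scale `c`. -/
lemma measureReal_ge_le_exp_neg_of_subGamma [IsProbabilityMeasure μ] {X : Ω → ℝ} {v c t : ℝ}
    (hv : 0 < v) (hc : 0 ≤ c) (ht : 0 < t)
    (hX : ∀ s, 0 ≤ s → s * c < 1 → Integrable (fun ω => Real.exp (s * X ω)) μ ∧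
      mgf X μ s ≤ Real.exp (s ^ 2 * v / (2 * (1 - s * c)))) :
    μ.real {ω | c * t + √(2 * v * t) ≤ X ω} ≤ Real.exp (-t) := by
  set r := √(2 * v * t) / v with hr
  have hr0 : 0 < r := by positivity
  have hsq : √(2 * v * t) = r * v := by rw [hr]; field_simp
  have hrv : r ^ 2 * v = 2 * t := by
    have h := Real.sq_sqrt (show 0 ≤ 2 * v * t by positivity)
    rw [hsq] at h
    exact mul_right_cancel₀ hv.ne' (by linarith)
  have hd : 0 < 1 + r * c := by positivity
  have h1 : 1 - r / (1 + r * c) * c = 1 / (1 + r * c) := by field_simp; ring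
  obtain ⟨hint, hmgf⟩ := hX (r / (1 + r * c)) (by positivity)
    (by have : 0 < 1 / (1 + r * c) := by positivity
        linarith)
  refine (measure_ge_le_exp_mul_mgf _ (by positivity) hint).trans ?_
  refine (mul_le_mul_of_nonneg_left hmgf (Real.exp_nonneg _)).trans ?_
  rw [← Real.exp_add, h1, hsq]
  apply le_of_eq
  congr 1
  have h2 : (r / (1 + r * c)) ^ 2 * v / (2 * (1 / (1 + r * c))) = t / (1 + r * c) := by
    field_simp
    linarith
  have h3 : r / (1 + r * c) * (c * t + r * v) = (r * c * t + 2 * t) / (1 + r * c) := by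
    rw [← hrv]; field_simp
  rw [h2, neg_mul, h3]
  field_simp
  ring

end Decoupled

/-- For independent `N(0, Σ)` Gaussian vectors `ε₁, ε₂`:
(i) the moment generating function of `⟨ε₁, ε₂⟩` equals `∏ᵢ (1 − λ² aᵢ²)^{−1/2}` (product over
the eigenvalues of `Σ`) whenever `|λ| ‖Σ‖ < 1`, and
(ii) `P(|⟨ε₁, ε₂⟩| > ‖Σ‖ t + sqrt(2 ‖Σ‖_F² t)) ≤ 2 e^{−t}` for all `t > 0`. -/
theorem stmt_8 {Ω : Type*} [MeasurableSpace Ω] (μ : Measure Ω) [IsProbabilityMeasure μ]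
    {d : ℕ} (Sigm : Matrix (Fin d) (Fin d) ℝ) (hS : Sigm.PosSemidef) (hS0 : Sigm ≠ 0)
    (ε₁ ε₂ : Ω → Fin d → ℝ) (h1 : Measurable ε₁) (h2 : Measurable ε₂)
    (hind : IndepFun ε₁ ε₂ μ)
    (hg1 : IsGaussianVec μ ε₁ 0 Sigm) (hg2 : IsGaussianVec μ ε₂ 0 Sigm) :
    (∀ lam : ℝ, |lam| * specNorm Sigm < 1 →
      ∫ ω, Real.exp (lam * ∑ i, ε₁ ω i * ε₂ ω i) ∂μ
        = ∏ i, (1 - lam ^ 2 * (hS.1.eigenvalues i) ^ 2) ^ (-(1 : ℝ) / 2)) ∧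
    (∀ t : ℝ, 0 < t →
      (μ {ω | specNorm Sigm * t + Real.sqrt (2 * (frobNorm Sigm) ^ 2 * t)
          < |∑ i, ε₁ ω i * ε₂ ω i|}).toReal ≤ 2 * Real.exp (-t)) := by
  have key : ∀ lam : ℝ, |lam| * specNorm Sigm < 1 → _ := fun lam h =>
    integrable_and_integral_exp_mul_inner hS h1 h2 hind hg1 hg2 h
  refine ⟨fun lam h => (key lam h).2, fun t ht => ?_⟩
  set X : Ω → ℝ := fun ω => ∑ i, ε₁ ω i * ε₂ ω i with hX
  have hc := specNorm_nonneg Sigm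
  have hv := frobNorm_sq_pos hS0
  have hprod : ∀ s, 0 ≤ s → s * specNorm Sigm < 1 →
      ∏ i, (1 - s ^ 2 * (hS.1.eigenvalues i) ^ 2) ^ (-(1 : ℝ) / 2)
        ≤ Real.exp (s ^ 2 * frobNorm Sigm ^ 2 / (2 * (1 - s * specNorm Sigm))) := by
    intro s hs0 hs
    rw [← sum_sq_eigenvalues hS.1, Finset.mul_sum, Finset.sum_div, Real.exp_sum]
    refine Finset.prod_le_prod (fun i _ => Real.rpow_nonneg ?_ _) fun i _ =>
      one_sub_sq_rpow_le_exp hs0 hs (abs_eigenvalues_le_specNorm hS.1 i)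
    have := sq_mul_sq_lt_one (s := s) (by rwa [abs_of_nonneg hs0])
      (abs_eigenvalues_le_specNorm hS.1 i)
    linarith
  have hpos := measureReal_ge_le_exp_neg_of_subGamma (μ := μ) (X := X) hv hc ht fun s hs0 hs => by
    obtain ⟨hi, he⟩ := key s (by rwa [abs_of_nonneg hs0])
    exact ⟨hi, he.trans_le (hprod s hs0 hs)⟩
  have hneg := measureReal_ge_le_exp_neg_of_subGamma (μ := μ) (X := -X) hv hc ht
    fun s hs0 hs => by
      obtain ⟨hi, he⟩ := key (-s) (by rwa [abs_neg, abs_of_nonneg hs0])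
      rw [neg_sq] at he
      rw [mgf_neg]
      exact ⟨by simpa [hX] using hi, he.trans_le (hprod s hs0 hs)⟩
  rw [two_mul (Real.exp (-t))]
  refine le_trans ?_ (add_le_add hpos hneg)
  refine le_trans ?_ (measureReal_union_le _ _)
  refine measureReal_mono fun ω hω => ?_
  rcases lt_abs.1 (Set.mem_ofPred.1 hω) with h | h
  · exact Or.inl h.le
  · exact Or.inr h.le
end

section
/- For any vectors X_{i,j} ∈ R^d (i = 1, …, m; j = 1, …, n) with m, n ≥ 2, the matrix R̂ admits the linear-time representation R̂ = ( n/(n−1) + 1/(m−1) ) · (1/m) Σ_{i=1}^m X̄_i X̄_i^T − (1/(m n(n−1))) Σ_{i=1}^m Σ_{j=1}^n X_{i,j} X_{i,j}^T − (m/(m−1)) X̄̄ X̄̄^T. -/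
open Matrix

/-- The sum of the symmetrized outer products over unordered pairs is the outer square of the sum
minus the sum of the outer squares. -/
theorem sum_lt_vecMulVec_add_vecMulVec {ι κ R : Type*} [Fintype ι] [LinearOrder ι] [CommRing R]
    (v : ι → κ → R) :
    (∑ j, ∑ j', if j < j' then (vecMulVec (v j) (v j') + vecMulVec (v j') (v j)) else 0)
      = vecMulVec (∑ j, v j) (∑ j, v j) - ∑ j, vecMulVec (v j) (v j) := by
  have hsq : vecMulVec (∑ j, v j) (∑ j, v j) = ∑ j, ∑ j', vecMulVec (v j) (v j') := by
    ext a b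
    simp [vecMulVec_apply, Matrix.sum_apply, Finset.sum_apply, Finset.sum_mul_sum]
  have hswap : (∑ j, ∑ j', if j < j' then vecMulVec (v j') (v j) else 0)
      = ∑ j, ∑ j', if j' < j then vecMulVec (v j) (v j') else 0 := Finset.sum_comm
  have hdiag : ∑ j, vecMulVec (v j) (v j)
      = ∑ j, ∑ j', if j = j' then vecMulVec (v j) (v j') else 0 := by
    simp
  have hsplit : (∑ j, ∑ j', if j < j' then (vecMulVec (v j) (v j') + vecMulVec (v j') (v j)) else 0)
      = (∑ j, ∑ j', if j < j' then vecMulVec (v j) (v j') else 0)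
        + ∑ j, ∑ j', if j < j' then vecMulVec (v j') (v j) else 0 := by
    simp only [← Finset.sum_add_distrib]
    refine Finset.sum_congr rfl fun j _ => Finset.sum_congr rfl fun j' _ => ?_
    split_ifs <;> simp
  rw [hsplit, hswap, hsq, hdiag, eq_sub_iff_add_eq]
  simp only [← Finset.sum_add_distrib]
  refine Finset.sum_congr rfl fun j _ => Finset.sum_congr rfl fun j' _ => ?_
  rcases lt_trichotomy j j' with h | rfl | h
  · simp [h, h.not_gt, h.ne]
  · simp
  · simp [h, h.not_gt, h.ne']

/-- Linear-time representation of the matrix `R̂` built from the multi-view data: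
`R̂ = (n/(n−1) + 1/(m−1)) · (1/m) ∑ᵢ X̄ᵢ X̄ᵢᵀ − (1/(m n (n−1))) ∑ᵢ ∑ⱼ Xᵢⱼ Xᵢⱼᵀ
     − (m/(m−1)) X̄̄ X̄̄ᵀ`. -/
theorem stmt_17 {d m n : ℕ} (hm : 2 ≤ m) (hn : 2 ≤ n) (X : Fin m → Fin n → Fin d → ℝ) :
    let Xbar : Fin m → Fin d → ℝ := fun i => (n : ℝ)⁻¹ • ∑ j, X i j
    let Xbb : Fin d → ℝ := (m : ℝ)⁻¹ • ∑ i, Xbar i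
    ((m : ℝ) * n * ((n : ℝ) - 1))⁻¹ •
        (∑ i, ∑ j, ∑ j', if j < j' then
          (vecMulVec (X i j) (X i j') + vecMulVec (X i j') (X i j)) else 0)
      - ((m : ℝ) * ((m : ℝ) - 1))⁻¹ •
        (∑ i, ∑ i', if i < i' then
          (vecMulVec (Xbar i) (Xbar i') + vecMulVec (Xbar i') (Xbar i)) else 0)
    = ((n : ℝ) / ((n : ℝ) - 1) + 1 / ((m : ℝ) - 1)) •
        ((m : ℝ)⁻¹ • ∑ i, vecMulVec (Xbar i) (Xbar i))
      - ((m : ℝ) * n * ((n : ℝ) - 1))⁻¹ • (∑ i, ∑ j, vecMulVec (X i j) (X i j))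
      - ((m : ℝ) / ((m : ℝ) - 1)) • vecMulVec Xbb Xbb := by
  intro Xbar Xbb
  have hm' : (2 : ℝ) ≤ m := by exact_mod_cast hm
  have hn' : (2 : ℝ) ≤ n := by exact_mod_cast hn
  have hm0 : (m : ℝ) ≠ 0 := by linarith
  have hn0 : (n : ℝ) ≠ 0 := by linarith
  have hm1 : (m : ℝ) - 1 ≠ 0 := by linarith
  have hn1 : (n : ℝ) - 1 ≠ 0 := by linarith
  have hX (i) : ∑ j, X i j = (n : ℝ) • Xbar i := (smul_inv_smul₀ hn0 _).symm
  have hXbar : ∑ i, Xbar i = (m : ℝ) • Xbb := (smul_inv_smul₀ hm0 _).symm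
  simp only [sum_lt_vecMulVec_add_vecMulVec, hX, hXbar, Finset.sum_sub_distrib, smul_vecMulVec,
    vecMulVec_smul, ← Finset.smul_sum]
  match_scalars <;> field_simp <;> ring
end
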